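/- (Theorem 4, conditional form.) Let T, T_W, and T_opt be multicast trees spanning M in an edge-weighted graph, each with at least 3 vertices. Suppose: Θ(T_W) ≤ Θ(S) for every multicast tree S spanning M; Ψ'(T_opt) ≤ Ψ'(S) for every multicast tree S spanning M; ε_r ≤ λ(v,T) for every v ∈ in(T); |lv(T)| ≤ |M| ≤ |nd(T_opt)|; and Θ(T) ≤ 48·Θ(T_W). Then Ψ'(T) ≤ 145·Ψ'(T_opt). -/

import Mathlib

namespace MEGCOM

/-- The set of internal nodes (degree at least 2) of a subgraph `T`. -/
def inn {V : Type*} {G : SimpleGraph V} (T : G.Subgraph) : Set V :=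
  {v | v ∈ T.verts ∧ 2 ≤ (T.neighborSet v).ncard}

/-- The set of degree-one nodes of a subgraph `T`. -/
def lv {V : Type*} {G : SimpleGraph V} (T : G.Subgraph) : Set V :=
  {v | v ∈ T.verts ∧ (T.neighborSet v).ncard = 1}

/-- `T` is a multicast tree spanning the member set `M`. -/
def IsMulticastTree {V : Type*} (G : SimpleGraph V) (M : Finset V) (T : G.Subgraph) : Prop :=
  T.coe.IsTree ∧ ↑M ⊆ T.verts

/-- `λ(u,T)`: the maximum weight of an edge of `T` incident to `u`. -/
noncomputable def lam {V : Type*} {G : SimpleGraph V} (w : V → V → ℝ)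
    (T : G.Subgraph) (u : V) : ℝ :=
  sSup (w u '' T.neighborSet u)

/-- `Θ(T) = ∑_{u ∈ in(T)} λ(u,T)`. -/
noncomputable def theta {V : Type*} {G : SimpleGraph V} (w : V → V → ℝ)
    (T : G.Subgraph) : ℝ :=
  ∑ᶠ u ∈ inn T, lam w T u

/-- Adjustable-power session energy `Ψ'(T)`. -/
noncomputable def psi' {V : Type*} [Fintype V] {G : SimpleGraph V} (w : V → V → ℝ)
    (T : G.Subgraph) (M : Finset V) (p : V → ℕ) (εr : ℝ) : ℝ :=
  (∑ u ∈ M, (p u : ℝ)) * theta w T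
    + (∑ᶠ u ∈ lv T, lam w T u * (p u : ℝ))
    + (∑ u ∈ M, (p u : ℝ)) * ((T.verts.ncard : ℝ) - 1) * εr

theorem aux_closed {V : Type*} {G : SimpleGraph V} {T : G.Subgraph} (hT : T.coe.IsTree)
    (S : Set V) (u : V) (hu : u ∈ T.verts) (huS : u ∈ S)
    (hS : ∀ a ∈ S, ∀ b, T.Adj a b → b ∈ S) : T.verts ⊆ S := by
  intro x hx
  obtain ⟨q⟩ := hT.connected.preconnected ⟨u, hu⟩ ⟨x, hx⟩
  have key : ∀ (a b : T.verts), T.coe.Walk a b → a.1 ∈ S → b.1 ∈ S := by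
    intro a b q
    induction q with
    | nil => exact id
    | cons h _ ih => exact fun ha => ih (hS _ ha _ (by simpa using h))
  exact key _ _ q huS

theorem aux_lam_le {V : Type*} [Fintype V] {G : SimpleGraph V} (w : V → V → ℝ)
    (T : G.Subgraph) (u v : V) (h : T.Adj u v) : w u v ≤ lam w T u :=
  le_csSup (Set.toFinite _).bddAbove ⟨v, h, rfl⟩

theorem aux_lam_nonneg {V : Type*} {G : SimpleGraph V} (w : V → V → ℝ)
    (hw : ∀ u v, 0 ≤ w u v) (T : G.Subgraph) (u : V) : 0 ≤ lam w T u := by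
  apply Real.sSup_nonneg
  rintro _ ⟨v, _, rfl⟩
  exact hw u v

theorem aux_pos {V : Type*} [Fintype V] {G : SimpleGraph V} {T : G.Subgraph}
    (hT : T.coe.IsTree) (h3 : 3 ≤ T.verts.ncard) (u : V) (hu : u ∈ T.verts) :
    1 ≤ (T.neighborSet u).ncard := by
  by_contra hc
  have h0 : (T.neighborSet u).ncard = 0 := by omega
  rw [Set.ncard_eq_zero (Set.toFinite _)] at h0
  have hsub : T.verts ⊆ {u} := by
    apply aux_closed hT {u} u hu rfl
    rintro a rfl b hab
    have : b ∈ T.neighborSet a := hab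
    rw [h0] at this
    exact this.elim
  have := Set.ncard_le_ncard hsub (Set.toFinite _)
  rw [Set.ncard_singleton] at this
  omega

theorem aux_leaf {V : Type*} [Fintype V] {G : SimpleGraph V} {T : G.Subgraph}
    (hT : T.coe.IsTree) (h3 : 3 ≤ T.verts.ncard) (u : V) (hu : u ∈ lv T) :
    ∃ v ∈ inn T, T.neighborSet u = {v} := by
  obtain ⟨hu, h1⟩ := hu
  obtain ⟨v, hv⟩ := Set.ncard_eq_one.1 h1
  have huv : T.Adj u v := by
    have : v ∈ T.neighborSet u := by rw [hv]; rfl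
    exact this
  refine ⟨v, ⟨huv.snd_mem, ?_⟩, hv⟩
  by_contra hc
  have hvu : u ∈ T.neighborSet v := huv.symm
  have h1' : (T.neighborSet v).ncard ≤ 1 := by omega
  have hsub : T.verts ⊆ {u, v} := by
    apply aux_closed hT {u, v} u hu (by simp)
    rintro a (rfl | rfl) b hab
    · have : b ∈ T.neighborSet a := hab
      rw [hv] at this
      exact Or.inr this
    · exact Or.inl ((Set.ncard_le_one (Set.toFinite _)).1 h1' b hab u hvu)
  have := Set.ncard_le_ncard hsub (Set.toFinite _)
  have := Set.ncard_pair huv.ne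
  omega

/-- Theorem 4, conditional form. -/
theorem stmt17 {V : Type*} [Fintype V] {G : SimpleGraph V} (w : V → V → ℝ)
    (hw_symm : ∀ u v, w u v = w v u) (hw_nonneg : ∀ u v, 0 ≤ w u v)
    (M : Finset V) (p : V → ℕ) (hp : ∀ u ∉ M, p u = 0)
    (T TW Topt : G.Subgraph)
    (hT : IsMulticastTree G M T) (hTW : IsMulticastTree G M TW)
    (hTopt : IsMulticastTree G M Topt)
    (h3T : 3 ≤ T.verts.ncard) (h3W : 3 ≤ TW.verts.ncard)
    (h3opt : 3 ≤ Topt.verts.ncard)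
    (εr : ℝ) (hεr : 0 < εr)
    (hWmin : ∀ S : G.Subgraph, IsMulticastTree G M S → theta w TW ≤ theta w S)
    (hoptmin : ∀ S : G.Subgraph, IsMulticastTree G M S →
      psi' w Topt M p εr ≤ psi' w S M p εr)
    (hlam : ∀ v ∈ inn T, εr ≤ lam w T v)
    (hlv : (lv T).ncard ≤ M.card) (hM : M.card ≤ Topt.verts.ncard)
    (hΘ : theta w T ≤ 48 * theta w TW) :
    psi' w T M p εr ≤ 145 * psi' w Topt M p εr := by
  classical
  have hL := aux_lam_nonneg w hw_nonneg T
  have hLo := aux_lam_nonneg w hw_nonneg Topt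
  have th : ∀ S : G.Subgraph, theta w S = ∑ u ∈ (inn S).toFinset, lam w S u := by
    intro S
    rw [theta, finsum_mem_eq_toFinset_sum]
  have hk : (0 : ℝ) ≤ ∑ u ∈ M, (p u : ℝ) := Finset.sum_nonneg fun _ _ => Nat.cast_nonneg _
  have hth0 : 0 ≤ theta w T := by
    rw [th]; exact Finset.sum_nonneg fun u _ => hL u
  have hlamle : ∀ u ∈ lv T, lam w T u ≤ theta w T := by
    intro u hu
    obtain ⟨v, hv, hn⟩ := aux_leaf hT.1 h3T u hu
    have huv : T.Adj u v := by
      have : v ∈ T.neighborSet u := by rw [hn]; rfl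
      exact this
    have e : lam w T u = w u v := by simp [lam, hn]
    calc lam w T u = w v u := by rw [e, hw_symm]
      _ ≤ lam w T v := aux_lam_le w T v u huv.symm
      _ ≤ theta w T := by
        rw [th]
        exact Finset.single_le_sum (f := fun u => lam w T u) (fun u _ => hL u) (by simpa using hv)
  have hleaf : (∑ᶠ u ∈ lv T, lam w T u * (p u : ℝ)) ≤ (∑ u ∈ M, (p u : ℝ)) * theta w T := by
    rw [finsum_mem_eq_toFinset_sum]
    calc ∑ u ∈ (lv T).toFinset, lam w T u * (p u : ℝ)
        ≤ ∑ u ∈ (lv T).toFinset, theta w T * (p u : ℝ) :=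
          Finset.sum_le_sum fun u hu =>
            mul_le_mul_of_nonneg_right (hlamle u (by simpa using hu)) (Nat.cast_nonneg _)
      _ ≤ ∑ u, theta w T * (p u : ℝ) :=
          Finset.sum_le_sum_of_subset_of_nonneg (Finset.subset_univ _)
            fun u _ _ => mul_nonneg hth0 (Nat.cast_nonneg _)
      _ = ∑ u ∈ M, theta w T * (p u : ℝ) := by
          symm
          apply Finset.sum_subset (Finset.subset_univ _)
          intro u _ hu
          simp [hp u hu]
      _ = (∑ u ∈ M, (p u : ℝ)) * theta w T := by rw [← Finset.mul_sum, mul_comm]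
  have hleafo : 0 ≤ ∑ᶠ u ∈ lv Topt, lam w Topt u * (p u : ℝ) := by
    rw [finsum_mem_eq_toFinset_sum]
    exact Finset.sum_nonneg fun u _ => mul_nonneg (hLo u) (Nat.cast_nonneg _)
  have hinn : ((inn T).ncard : ℝ) * εr ≤ theta w T := by
    rw [th, Set.ncard_eq_toFinset_card', ← nsmul_eq_mul]
    exact Finset.card_nsmul_le_sum _ _ _ fun u hu => hlam u (by simpa using hu)
  have hcov : T.verts ⊆ inn T ∪ lv T := by
    intro u hu
    have := aux_pos hT.1 h3T u hu
    rcases Nat.lt_or_ge 1 (T.neighborSet u).ncard with h | h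
    · exact Or.inl ⟨hu, h⟩
    · exact Or.inr ⟨hu, le_antisymm h this⟩
  have hcard : T.verts.ncard ≤ (inn T).ncard + Topt.verts.ncard := by
    have h1 := Set.ncard_le_ncard hcov (Set.toFinite _)
    have h2 := Set.ncard_union_le (inn T) (lv T)
    omega
  have hcard' : (T.verts.ncard : ℝ) ≤ (inn T).ncard + Topt.verts.ncard := by exact_mod_cast hcard
  have hrec : ((T.verts.ncard : ℝ) - 1) * εr
      ≤ theta w T + ((Topt.verts.ncard : ℝ) - 1) * εr := by
    nlinarith
  have ho1 : 0 ≤ ((Topt.verts.ncard : ℝ) - 1) * εr := by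
    have : (3 : ℝ) ≤ Topt.verts.ncard := by exact_mod_cast h3opt
    exact mul_nonneg (by linarith) hεr.le
  have hTo : theta w T ≤ 48 * theta w Topt := by
    have := hWmin Topt hTopt
    linarith
  have hto0 : 0 ≤ theta w Topt := by linarith
  unfold psi'
  rw [mul_assoc, mul_assoc]
  generalize (∑ u ∈ M, (p u : ℝ)) = k at *
  have a1 := mul_le_mul_of_nonneg_left hrec hk
  have a2 := mul_le_mul_of_nonneg_left hTo hk
  have a3 := mul_nonneg hk ho1
  have a4 := mul_nonneg hk hto0
  rw [mul_add] at a1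
  linarith

end MEGCOM
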